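/- arXiv:2002.05924 — 6 statements merged into one kernel-verified Lean document; each statement's English description precedes it below -/
import Mathlib

section
/- Let K be a field and A an algebra over K. Assume that either (i) x*x = 0 for all x ∈ A, or (ii) there exist α, β ∈ K, not both zero, such that α•(x*y) + β•(y*x) = 0 for all x, y ∈ A. Then A is commutative or A is anticommutative, i.e. either x*y = y*x holds for all x, y ∈ A, or x*y = -(y*x) holds for all x, y ∈ A. -/
/-- A non-trivial homogeneous identity of degree 2 on a non-associative algebra `A`
over a field `K` forces commutativity or anticommutativity. -/
theorem degree_two_identity_implies_comm_or_anticomm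
    {K A : Type*} [Field K] [AddCommGroup A] [Module K A]
    (mul : A →ₗ[K] A →ₗ[K] A)
    (h : (∀ x : A, mul x x = 0) ∨
      ∃ α β : K, (α ≠ 0 ∨ β ≠ 0) ∧ ∀ x y : A, α • mul x y + β • mul y x = 0) :
    (∀ x y : A, mul x y = mul y x) ∨ (∀ x y : A, mul x y = -(mul y x)) := by
  have anticomm (hsq : ∀ x : A, mul x x = 0) (x y : A) : mul x y = -(mul y x) := by
    have hxy := hsq (x + y)
    simp only [map_add, LinearMap.add_apply, hsq, zero_add, add_zero] at hxy
    exact eq_neg_of_add_eq_zero_right hxy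
  obtain hsq | ⟨α, β, hne, hid⟩ := h
  · exact Or.inr (anticomm hsq)
  by_cases hsum : α + β = 0
  · obtain rfl : β = -α := eq_neg_of_add_eq_zero_right hsum
    have hα : α ≠ 0 := by simpa using hne
    refine Or.inl fun x y => smul_right_injective A hα ?_
    simpa [add_neg_eq_zero] using hid x y
  · refine Or.inr (anticomm fun x => ?_)
    have hxx := hid x x
    rw [← add_smul] at hxx
    exact (smul_eq_zero.mp hxx).resolve_left hsum
end

section
/- Let K be a field, A an algebra over K, and λ ∈ K such that x*y + λ•(y*x) = 0 for all x, y ∈ A. Then (1 - λ²)•(x*y) = 0 for all x, y ∈ A. Consequently, if the multiplication of A is not identically zero, then λ = 1 or λ = -1. -/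
/-- If `x*y + λ•(y*x) = 0` holds in a `K`-algebra `A`, then `(1 - λ²)•(x*y) = 0` for
all `x, y`; hence if the multiplication is not identically zero, `λ = 1` or `λ = -1`. -/
theorem degree_two_identity_coefficient
    {K A : Type*} [Field K] [AddCommGroup A] [Module K A]
    (mul : A →ₗ[K] A →ₗ[K] A) (lam : K)
    (h : ∀ x y : A, mul x y + lam • mul y x = 0) :
    (∀ x y : A, (1 - lam ^ 2) • mul x y = 0) ∧
      ((∃ x y : A, mul x y ≠ 0) → lam = 1 ∨ lam = -1) := by
  have key : ∀ x y : A, (1 - lam ^ 2) • mul x y = 0 := by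
    intro x y
    calc (1 - lam ^ 2) • mul x y
        = (mul x y + lam • mul y x) - lam • (mul y x + lam • mul x y) := by module
      _ = 0 := by rw [h x y, h y x, smul_zero, sub_zero]
  refine ⟨key, ?_⟩
  rintro ⟨x, y, hxy⟩
  have hlam : 1 - lam ^ 2 = 0 := (smul_eq_zero.mp (key x y)).resolve_right hxy
  exact sq_eq_one_iff.mp (sub_eq_zero.mp hlam).symm
end

section
/- Let K be a field and A an anticommutative algebra over K (x*y = -(y*x) for all x, y). Suppose there exist λ₁, ..., λ₈ ∈ K such that z*(x*y) = λ₁•((z*x)*y) + λ₂•((x*z)*y) + λ₃•(y*(z*x)) + λ₄•(y*(x*z)) + λ₅•((z*y)*x) + λ₆•((y*z)*x) + λ₇•(x*(z*y)) + λ₈•(x*(y*z)) holds for all x, y, z ∈ A. Then there exist λ, μ ∈ K such that x*(y*z) = λ•((x*y)*z) + μ•(y*(x*z)) holds for all x, y, z ∈ A. -/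
/-- In an anticommutative algebra satisfying one of the λ/μ-rules (an eight-term
identity of degree three), there are `λ, μ` with `x*(y*z) = λ•((x*y)*z) + μ•(y*(x*z))`. -/
theorem anticomm_lambda_mu_rule_reduces
    {K A : Type*} [Field K] [AddCommGroup A] [Module K A]
    (mul : A →ₗ[K] A →ₗ[K] A)
    (anti : ∀ x y : A, mul x y = -(mul y x))
    (l₁ l₂ l₃ l₄ l₅ l₆ l₇ l₈ : K)
    (h : ∀ x y z : A, mul z (mul x y) =
        l₁ • mul (mul z x) y + l₂ • mul (mul x z) y +
        l₃ • mul y (mul z x) + l₄ • mul y (mul x z) +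
        l₅ • mul (mul z y) x + l₆ • mul (mul y z) x +
        l₇ • mul x (mul z y) + l₈ • mul x (mul y z)) :
    ∃ lam mu : K, ∀ x y z : A,
      mul x (mul y z) = lam • mul (mul x y) z + mu • mul y (mul x z) := by
  refine ⟨l₁ - l₂ - l₃ + l₄, -l₅ + l₆ + l₇ - l₈, fun x y z => ?_⟩
  rw [h y z x, anti y x, anti z x, anti z (mul x y), anti z (-mul x y), anti (mul x z) y,
    anti (-mul x z) y]
  simp only [map_neg, LinearMap.neg_apply, neg_neg]
  module
end

section
/- Let K be a field, λ, μ ∈ K, and A an anticommutative algebra over K (x*y = -(y*x) for all x, y) satisfying x*(y*z) = λ•((x*y)*z) + μ•(y*(x*z)) for all x, y, z ∈ A. Then A satisfies (1 - λμ)•(x*(y*z)) = (μ - λ²)•(y*(x*z)) for all x, y, z ∈ A. Consequently, if there exist u, v, w ∈ A such that u*(v*w) and v*(u*w) are linearly independent over K, then λμ = 1 and μ = λ². -/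
/-- In an anticommutative algebra satisfying `x*(y*z) = λ•((x*y)*z) + μ•(y*(x*z))`,
one has `(1 - λμ)•(x*(y*z)) = (μ - λ²)•(y*(x*z))`; hence if some `u*(v*w)` and
`v*(u*w)` are linearly independent, then `λμ = 1` and `μ = λ²`. -/
theorem anticomm_two_param_rule_forces_jacobi_coefficients
    {K A : Type*} [Field K] [AddCommGroup A] [Module K A]
    (mul : A →ₗ[K] A →ₗ[K] A) (lam mu : K)
    (anti : ∀ x y : A, mul x y = -(mul y x))
    (h : ∀ x y z : A,
      mul x (mul y z) = lam • mul (mul x y) z + mu • mul y (mul x z)) :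
    (∀ x y z : A,
      (1 - lam * mu) • mul x (mul y z) = (mu - lam ^ 2) • mul y (mul x z)) ∧
    ((∃ u v w : A, LinearIndependent K ![mul u (mul v w), mul v (mul u w)]) →
      lam * mu = 1 ∧ mu = lam ^ 2) := by
  have key : ∀ x y z : A,
      (1 - lam * mu) • mul x (mul y z) = (mu - lam ^ 2) • mul y (mul x z) := by
    intro x y z
    have hright : mul (mul z x) y = mul y (mul x z) := by
      rw [anti (mul z x) y, anti z x, map_neg, neg_neg]
    have hleft : mul (mul x y) z = mu • mul x (mul y z) - lam • mul y (mul x z) := by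
      rw [anti (mul x y) z, h z x y, hright, anti z y, map_neg]
      module
    have hexp := h x y z
    rw [hleft] at hexp
    linear_combination (norm := module) hexp
  refine ⟨key, ?_⟩
  rintro ⟨u, v, w, hli⟩
  rw [LinearIndependent.pair_iff] at hli
  obtain ⟨h₁, h₂⟩ := hli (1 - lam * mu) (-(mu - lam ^ 2)) (by
    rw [key u v w, neg_smul, add_neg_cancel])
  exact ⟨(sub_eq_zero.mp h₁).symm, sub_eq_zero.mp (neg_eq_zero.mp h₂)⟩
end

section
/- Let K be a field, λ, μ ∈ K, and A a commutative algebra over K (x*y = y*x for all x, y) satisfying x*(y*z) = λ•((x*y)*z) + μ•(y*(x*z)) for all x, y, z ∈ A. Then A satisfies (1 - λμ)•(x*(y*z)) = (λ² + μ)•(y*(x*z)) for all x, y, z ∈ A. Consequently, if there exist u, v, w ∈ A such that u*(v*w) and v*(u*w) are linearly independent over K, then λμ = 1 and μ = -λ². -/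
/-- In a commutative algebra satisfying `x*(y*z) = λ•((x*y)*z) + μ•(y*(x*z))`,
one has `(1 - λμ)•(x*(y*z)) = (λ² + μ)•(y*(x*z))`; hence if some `u*(v*w)` and
`v*(u*w)` are linearly independent, then `λμ = 1` and `μ = -λ²`. -/
theorem comm_two_param_rule_forces_coefficients
    {K A : Type*} [Field K] [AddCommGroup A] [Module K A]
    (mul : A →ₗ[K] A →ₗ[K] A) (lam mu : K)
    (comm : ∀ x y : A, mul x y = mul y x)
    (h : ∀ x y z : A,
      mul x (mul y z) = lam • mul (mul x y) z + mu • mul y (mul x z)) :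
    (∀ x y z : A,
      (1 - lam * mu) • mul x (mul y z) = (lam ^ 2 + mu) • mul y (mul x z)) ∧
    ((∃ u v w : A, LinearIndependent K ![mul u (mul v w), mul v (mul u w)]) →
      lam * mu = 1 ∧ mu = -lam ^ 2) := by
  have key : ∀ x y z : A,
      (1 - lam * mu) • mul x (mul y z) = (lam ^ 2 + mu) • mul y (mul x z) := by
    intro x y z
    have hxyz := h x y z
    have hzxy := h z x y
    rw [comm z (mul x y), comm z x, comm (mul x z) y, comm z y] at hzxy
    rw [hzxy] at hxyz
    linear_combination (norm := module) hxyz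
  refine ⟨key, ?_⟩
  rintro ⟨u, v, w, hli⟩
  obtain ⟨h₁, h₂⟩ := LinearIndependent.pair_iff.mp hli (1 - lam * mu) (-(lam ^ 2 + mu))
    (by rw [key u v w, neg_smul, add_neg_cancel])
  exact ⟨by linear_combination -h₁, by linear_combination -h₂⟩
end

section
/- Let K be a field and A a commutative algebra over K (x*y = y*x for all x, y) satisfying x*(y*z) = -((x*y)*z) - y*(x*z) for all x, y, z ∈ A. Then for all a, b, c, w ∈ A, 2•( Σ_{σ ∈ S₃} x_{σ(1)}*(x_{σ(2)}*(x_{σ(3)}*w)) ) = 0, where (x₁, x₂, x₃) = (a, b, c) and the sum runs over all six permutations σ of {1,2,3}. In particular, if the characteristic of K is different from 2, then Σ_{σ ∈ S₃} x_{σ(1)}*(x_{σ(2)}*(x_{σ(3)}*w)) = 0 for all a, b, c, w ∈ A. -/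
/-- In a commutative algebra satisfying `x*(y*z) = -((x*y)*z) - y*(x*z)`, twice the
fully symmetrised triple product `Σ_{σ ∈ S₃} x_{σ(1)}*(x_{σ(2)}*(x_{σ(3)}*w))`
vanishes; in particular it vanishes whenever `char K ≠ 2`. -/
theorem comm_neg_rule_symmetrised_sum_vanishes
    {K A : Type*} [Field K] [AddCommGroup A] [Module K A]
    (mul : A →ₗ[K] A →ₗ[K] A)
    (comm : ∀ x y : A, mul x y = mul y x)
    (h : ∀ x y z : A,
      mul x (mul y z) = -(mul (mul x y) z) - mul y (mul x z)) :
    (∀ a b c w : A,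
      (2 : K) • ∑ σ : Equiv.Perm (Fin 3),
        mul (![a, b, c] (σ 0)) (mul (![a, b, c] (σ 1)) (mul (![a, b, c] (σ 2)) w))
        = 0) ∧
    (ringChar K ≠ 2 → ∀ a b c w : A,
      ∑ σ : Equiv.Perm (Fin 3),
        mul (![a, b, c] (σ 0)) (mul (![a, b, c] (σ 1)) (mul (![a, b, c] (σ 2)) w))
        = 0) := by
  have expand (x y z : A) : mul (mul x y) z = -mul x (mul y z) - mul y (mul x z) := by
    rw [h x y z]; abel
  have expand_triple (x y z w : A) : mul (mul (mul x y) z) w =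
      mul x (mul y (mul z w)) + mul y (mul x (mul z w))
        + mul z (mul x (mul y w)) + mul z (mul y (mul x w)) := by
    rw [expand (mul x y) z w, expand x y (mul z w), expand x y w]
    simp only [map_sub, map_neg]
    abel
  have jacobi (x y z : A) : mul (mul x y) z + mul (mul y z) x + mul (mul z x) y = 0 := by
    rw [expand x y z, comm (mul y z) x, comm (mul z x) y, comm z x]
    abel
  have two_smul_sum (a b c w : A) : (2 : K) • ∑ σ : Equiv.Perm (Fin 3),
      mul (![a, b, c] (σ 0)) (mul (![a, b, c] (σ 1)) (mul (![a, b, c] (σ 2)) w)) = 0 := by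
    have sum_eq : ∑ σ : Equiv.Perm (Fin 3),
        mul (![a, b, c] (σ 0)) (mul (![a, b, c] (σ 1)) (mul (![a, b, c] (σ 2)) w)) =
        mul a (mul b (mul c w)) + mul a (mul c (mul b w)) + mul b (mul a (mul c w))
          + mul b (mul c (mul a w)) + mul c (mul a (mul b w)) + mul c (mul b (mul a w)) := by
      have univ_eq : (Finset.univ : Finset (Equiv.Perm (Fin 3))) =
          {1, Equiv.swap 1 2, Equiv.swap 0 1, Equiv.swap 0 1 * Equiv.swap 1 2,
            Equiv.swap 1 2 * Equiv.swap 0 1, Equiv.swap 0 2} := by decide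
      rw [univ_eq]
      repeat rw [Finset.sum_insert (by decide)]
      rw [Finset.sum_singleton]
      simp [Equiv.swap_apply_def]
      abel
    have jacobi_apply := congrArg (fun u => mul u w) (jacobi a b c)
    simp only [map_add, LinearMap.add_apply, map_zero, LinearMap.zero_apply,
      expand_triple] at jacobi_apply
    rw [sum_eq, two_smul, ← jacobi_apply]
    abel
  refine ⟨two_smul_sum, fun hK a b c w => ?_⟩
  exact (smul_eq_zero.mp (two_smul_sum a b c w)).resolve_left (Ring.two_ne_zero hK)
end
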